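/- Let G be a finite simple bipartite graph with vertex bipartition A ⊔ B, with m edges, where L = |A|, R = |B|, 100 ≤ L ≤ R, and set n = 2^(⌈log₂(L+R)⌉). Suppose m/⌈log₂(L+R)⌉^10 > L + R + (L·R)^(2/3). Then there exist disjoint subsets A', A'' ⊆ A, disjoint subsets B', B'' ⊆ B, and positive reals d_L', d_R', d_L'' such that: (1) every vertex v ∈ A' satisfies d_L'/4 ≤ |N(v) ∩ B'| ≤ d_L', and e(A', B') ≥ m/(log₂ n)⁴; (2) every vertex v ∈ B' satisfies d_R'/4 ≤ |N(v) ∩ A''| ≤ d_R', and e(B', A'') ≥ m/(log₂ n)⁴; (3) every vertex v ∈ A'' satisfies d_L''/4 ≤ |N(v) ∩ B''| ≤ d_L'', and e(A'', B'') ≥ m/(log₂ n)⁴. -/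

import Mathlib

open SimpleGraph

/-- The number of edges of `G` with one endpoint in `X` and the other in `Y`. -/
noncomputable def eCount {V : Type*} (G : SimpleGraph V) (X Y : Set V) : ℕ :=
  {e ∈ G.edgeSet | ∃ u ∈ X, ∃ v ∈ Y, e = s(u, v)}.ncard

/-- Greedy signing: `Y` splits into two parts whose row sums are close in mean square. -/
theorem exists_split_sum_sq_le {α β : Type*} [DecidableEq β] (a : α → β → ℝ)
    (S : Finset α) (Y : Finset β) :
    ∃ Y₁ Y₂ : Finset β, Disjoint Y₁ Y₂ ∧ Y₁ ∪ Y₂ = Y ∧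
      ∑ x ∈ S, (∑ y ∈ Y₁, a x y - ∑ y ∈ Y₂, a x y) ^ 2 ≤ ∑ x ∈ S, ∑ y ∈ Y, a x y ^ 2 := by
  induction Y using Finset.induction_on with
  | empty => exact ⟨∅, ∅, by simp⟩
  | insert b Y hb ih =>
    obtain ⟨Y₁, Y₂, hd, hu, h⟩ := ih
    have h₁ : b ∉ Y₁ := fun hy => hb (hu ▸ Finset.mem_union_left _ hy)
    have h₂ : b ∉ Y₂ := fun hy => hb (hu ▸ Finset.mem_union_right _ hy)
    set c : ℝ := ∑ x ∈ S, (∑ y ∈ Y₁, a x y - ∑ y ∈ Y₂, a x y) * a x b with hc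
    have hins : ∑ x ∈ S, ∑ y ∈ insert b Y, a x y ^ 2 =
        ∑ x ∈ S, a x b ^ 2 + ∑ x ∈ S, ∑ y ∈ Y, a x y ^ 2 := by
      simp only [Finset.sum_insert hb, Finset.sum_add_distrib]
    rcases le_total c 0 with hc0 | hc0
    · refine ⟨insert b Y₁, Y₂, Finset.disjoint_insert_left.2 ⟨h₂, hd⟩, by
        rw [Finset.insert_union, hu], ?_⟩
      have key : ∑ x ∈ S, (∑ y ∈ insert b Y₁, a x y - ∑ y ∈ Y₂, a x y) ^ 2 =
          ∑ x ∈ S, (∑ y ∈ Y₁, a x y - ∑ y ∈ Y₂, a x y) ^ 2 + 2 * c + ∑ x ∈ S, a x b ^ 2 := by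
        rw [hc, Finset.mul_sum, ← Finset.sum_add_distrib, ← Finset.sum_add_distrib]
        refine Finset.sum_congr rfl fun x _ => ?_
        rw [Finset.sum_insert h₁]
        ring
      linarith
    · refine ⟨Y₁, insert b Y₂, Finset.disjoint_insert_right.2 ⟨h₁, hd⟩, by
        rw [Finset.union_insert, hu], ?_⟩
      have key : ∑ x ∈ S, (∑ y ∈ Y₁, a x y - ∑ y ∈ insert b Y₂, a x y) ^ 2 =
          ∑ x ∈ S, (∑ y ∈ Y₁, a x y - ∑ y ∈ Y₂, a x y) ^ 2 - 2 * c + ∑ x ∈ S, a x b ^ 2 := by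
        rw [hc, Finset.mul_sum, ← Finset.sum_sub_distrib, ← Finset.sum_add_distrib]
        refine Finset.sum_congr rfl fun x _ => ?_
        rw [Finset.sum_insert h₂]
        ring
      linarith

/-- A mean-square bound controls the sum over any subset. -/
theorem abs_sum_le_of_sum_sq_le {α : Type*} (f : α → ℝ) {S X : Finset α} (hX : X ⊆ S)
    {t M : ℝ} (ht : 0 < t) (hM : ∑ x ∈ S, f x ^ 2 ≤ M) (hS : t ^ 2 * S.card ≤ M) :
    |∑ x ∈ X, f x| ≤ M / t := by
  have h₁ : |∑ x ∈ X, f x| ≤ ∑ x ∈ S, |f x| :=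
    (Finset.abs_sum_le_sum_abs _ _).trans
      (Finset.sum_le_sum_of_subset_of_nonneg hX fun _ _ _ => abs_nonneg _)
  have h₂ : 2 * t * ∑ x ∈ S, |f x| ≤ ∑ x ∈ S, f x ^ 2 + t ^ 2 * S.card := by
    have : ∑ x ∈ S, f x ^ 2 + t ^ 2 * S.card = ∑ x ∈ S, (f x ^ 2 + t ^ 2) := by
      rw [Finset.sum_add_distrib, Finset.sum_const, nsmul_eq_mul, mul_comm (t ^ 2)]
    rw [this, Finset.mul_sum]
    refine Finset.sum_le_sum fun x _ => ?_
    nlinarith [sq_nonneg (|f x| - t), sq_abs (f x)]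
  rw [le_div_iff₀ ht]
  nlinarith

/-- Dyadic pigeonhole. -/
theorem exists_dyadic_subset {α : Type*} (f : α → ℕ) (X : Finset α) {k : ℕ} (hk : 0 < k)
    (hf : ∀ x ∈ X, f x < 2 ^ k) :
    ∃ X' ⊆ X, ∃ d : ℝ, 0 < d ∧ (∀ x ∈ X', d / 4 ≤ (f x : ℝ) ∧ (f x : ℝ) ≤ d) ∧
      (∑ x ∈ X, (f x : ℝ)) ≤ k * ∑ x ∈ X', (f x : ℝ) := by
  set Z := X.filter fun x => f x ≠ 0
  have hmaps : ∀ x ∈ Z, Nat.log 2 (f x) ∈ Finset.range k := fun x hx => by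
    obtain ⟨hx, h0⟩ := Finset.mem_filter.1 hx
    exact Finset.mem_range.2 (Nat.log_lt_of_lt_pow h0 (hf x hx))
  have hZ : ∑ x ∈ X, (f x : ℝ) = ∑ x ∈ Z, (f x : ℝ) := by
    refine (Finset.sum_filter_of_ne fun x _ h => ?_).symm
    exact_mod_cast h
  obtain ⟨i, -, hi⟩ := Finset.exists_le_of_sum_le (s := Finset.range k)
    (f := fun _ => (∑ x ∈ X, (f x : ℝ)) / k)
    (g := fun i => ∑ x ∈ Z with Nat.log 2 (f x) = i, (f x : ℝ))
    ⟨0, Finset.mem_range.2 hk⟩ (by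
      rw [Finset.sum_fiberwise_of_maps_to hmaps, hZ, Finset.sum_const, Finset.card_range,
        nsmul_eq_mul, mul_div_cancel₀]
      exact_mod_cast hk.ne')
  refine ⟨Z.filter fun x => Nat.log 2 (f x) = i,
    (Finset.filter_subset _ _).trans (Finset.filter_subset _ _), 2 ^ (i + 1), by positivity,
    fun x hx => ?_, ?_⟩
  · obtain ⟨hxZ, rfl⟩ := Finset.mem_filter.1 hx
    have h0 := (Finset.mem_filter.1 hxZ).2
    have hlo : ((2 : ℝ) ^ Nat.log 2 (f x)) ≤ f x := by exact_mod_cast Nat.pow_log_le_self 2 h0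
    have hhi : (f x : ℝ) ≤ 2 ^ (Nat.log 2 (f x) + 1) := by
      exact_mod_cast (Nat.lt_pow_succ_log_self one_lt_two (f x)).le
    refine ⟨?_, hhi⟩
    have : (0 : ℝ) < 2 ^ Nat.log 2 (f x) := by positivity
    rw [pow_succ]
    linarith
  · rwa [div_le_iff₀' (by exact_mod_cast hk)] at hi

theorem eCount_eq_card_edgeFinset {V : Type*} [Fintype V] (G : SimpleGraph V)
    [DecidableRel G.Adj] {A B : Finset V}
    (hbip : ∀ u v : V, G.Adj u v → (u ∈ A ∧ v ∈ B) ∨ (u ∈ B ∧ v ∈ A)) :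
    eCount G ↑A ↑B = G.edgeFinset.card := by
  rw [eCount, ← Set.ncard_coe_finset, SimpleGraph.coe_edgeFinset]
  congr 1
  ext e
  refine ⟨fun h => h.1, fun h => ⟨h, ?_⟩⟩
  induction e with
  | h u v =>
    rcases hbip u v h with ⟨hu, hv⟩ | ⟨hu, hv⟩
    · exact ⟨u, hu, v, hv, rfl⟩
    · exact ⟨v, hv, u, hu, Sym2.eq_swap⟩

section

variable {V : Type*} [Fintype V] [DecidableEq V] (G : SimpleGraph V) [DecidableRel G.Adj]

theorem card_neighborFinset_inter_eq_sum (v : V) (Y : Finset V) :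
    ((G.neighborFinset v ∩ Y).card : ℝ) = ∑ y ∈ Y, if G.Adj v y then (1 : ℝ) else 0 := by
  rw [Finset.sum_boole]
  congr 2
  ext y
  simp [and_comm]

theorem sum_card_neighborFinset_inter_comm (X Y : Finset V) :
    ∑ x ∈ X, ((G.neighborFinset x ∩ Y).card : ℝ) =
      ∑ y ∈ Y, ((G.neighborFinset y ∩ X).card : ℝ) := by
  simp only [card_neighborFinset_inter_eq_sum]
  rw [Finset.sum_comm]
  simp only [G.adj_comm]

theorem eCount_eq_sum {X Y : Finset V} (h : Disjoint X Y) :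
    (eCount G ↑X ↑Y : ℝ) = ∑ x ∈ X, ((G.neighborFinset x ∩ Y).card : ℝ) := by
  have himg : {e ∈ G.edgeSet | ∃ u ∈ (X : Set V), ∃ v ∈ (Y : Set V), e = s(u, v)} =
      ↑((X.sigma fun x => G.neighborFinset x ∩ Y).image fun p => s(p.1, p.2)) := by
    ext e
    simp only [Set.mem_ofPred_eq, Finset.coe_image, Set.mem_image, Finset.mem_coe,
      Finset.mem_sigma, Finset.mem_inter, SimpleGraph.mem_neighborFinset]
    constructor
    · rintro ⟨he, u, hu, v, hv, rfl⟩
      exact ⟨⟨u, v⟩, ⟨hu, he, hv⟩, rfl⟩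
    · rintro ⟨⟨u, v⟩, ⟨hu, he, hv⟩, rfl⟩
      exact ⟨he, u, hu, v, hv, rfl⟩
  rw [eCount, himg, Set.ncard_coe_finset, Finset.card_image_of_injOn, Finset.card_sigma,
    Nat.cast_sum]
  rintro ⟨u, v⟩ hp ⟨u', v'⟩ hq hpq
  simp only [Finset.mem_coe, Finset.mem_sigma, Finset.mem_inter] at hp hq
  rcases Sym2.eq_iff.1 hpq with ⟨h₁, h₂⟩ | ⟨h₁, h₂⟩
  · cases h₁
    cases h₂
    rfl
  · exact absurd ((show u = v' from h₁).symm ▸ hq.2.2 : u ∈ Y) (Finset.disjoint_left.1 h hp.1)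

/-- `Y` splits into two parts receiving nearly equally many edges from each `X ⊆ S`. -/
theorem exists_balanced_split (S Y : Finset V) {t M : ℝ} (ht : 0 < t)
    (hM : ∑ x ∈ S, ((G.neighborFinset x ∩ Y).card : ℝ) = M) (hS : t ^ 2 * S.card ≤ M) :
    ∃ Y₁ Y₂ : Finset V, Disjoint Y₁ Y₂ ∧ Y₁ ∪ Y₂ = Y ∧ ∀ X ⊆ S,
      |∑ x ∈ X, ((G.neighborFinset x ∩ Y₁).card : ℝ) -
        ∑ x ∈ X, ((G.neighborFinset x ∩ Y₂).card : ℝ)| ≤ M / t := by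
  obtain ⟨Y₁, Y₂, hd, hu, h⟩ :=
    exists_split_sum_sq_le (fun x y => if G.Adj x y then (1 : ℝ) else 0) S Y
  refine ⟨Y₁, Y₂, hd, hu, fun X hX => ?_⟩
  rw [← Finset.sum_sub_distrib]
  refine abs_sum_le_of_sum_sq_le _ hX ht ?_ hS
  simp only [ite_pow, one_pow, ne_eq, OfNat.ofNat_ne_zero, not_false_eq_true, zero_pow,
    ← card_neighborFinset_inter_eq_sum, hM] at h
  exact h

end

/-- Organizing the bipartite graph (Claim `somestruct`): existence of disjoint
degree-regular pieces `A', A'' ⊆ A` and `B', B'' ⊆ B` each capturing at least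
`m/(log₂ n)⁴` edges. -/
theorem organize_bipartite_graph
    {V : Type} [Fintype V] [DecidableEq V] (G : SimpleGraph V) [DecidableRel G.Adj]
    (A B : Finset V) (hdisj : Disjoint A B) (hcover : A ∪ B = Finset.univ)
    (hbip : ∀ u v : V, G.Adj u v → (u ∈ A ∧ v ∈ B) ∨ (u ∈ B ∧ v ∈ A))
    (L R m n : ℕ)
    (hL : L = A.card) (hR : R = B.card) (hm : m = G.edgeFinset.card)
    (hn : n = 2 ^ Nat.clog 2 (L + R))
    (hL100 : 100 ≤ L) (hLR : L ≤ R)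
    (hbig : (m : ℝ) / (Nat.clog 2 (L + R) : ℝ) ^ 10 >
      (L : ℝ) + (R : ℝ) + ((L : ℝ) * (R : ℝ)) ^ ((2 : ℝ) / 3)) :
    ∃ (A' A'' B' B'' : Finset V) (dL' dR' dL'' : ℝ),
      A' ⊆ A ∧ A'' ⊆ A ∧ Disjoint A' A'' ∧
      B' ⊆ B ∧ B'' ⊆ B ∧ Disjoint B' B'' ∧
      0 < dL' ∧ 0 < dR' ∧ 0 < dL'' ∧
      (∀ v ∈ A', dL' / 4 ≤ ((G.neighborFinset v ∩ B').card : ℝ) ∧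
        ((G.neighborFinset v ∩ B').card : ℝ) ≤ dL') ∧
      (eCount G ↑A' ↑B' : ℝ) ≥ (m : ℝ) / (Real.logb 2 (n : ℝ)) ^ 4 ∧
      (∀ v ∈ B', dR' / 4 ≤ ((G.neighborFinset v ∩ A'').card : ℝ) ∧
        ((G.neighborFinset v ∩ A'').card : ℝ) ≤ dR') ∧
      (eCount G ↑B' ↑A'' : ℝ) ≥ (m : ℝ) / (Real.logb 2 (n : ℝ)) ^ 4 ∧
      (∀ v ∈ A'', dL'' / 4 ≤ ((G.neighborFinset v ∩ B'').card : ℝ) ∧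
        ((G.neighborFinset v ∩ B'').card : ℝ) ≤ dL'') ∧
      (eCount G ↑A'' ↑B'' : ℝ) ≥ (m : ℝ) / (Real.logb 2 (n : ℝ)) ^ 4 := by
  set k := Nat.clog 2 (L + R) with hk
  have hcard : Fintype.card V = L + R := by
    rw [← Finset.card_univ, ← hcover, Finset.card_union_of_disjoint hdisj, hL, hR]
  have hpow : L + R ≤ 2 ^ k := Nat.le_pow_clog one_lt_two _
  have hk8 : 8 ≤ k := by
    by_contra! hlt
    have : 2 ^ k ≤ 2 ^ 7 := Nat.pow_le_pow_right two_pos (by omega)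
    omega
  have hk8' : (8 : ℝ) ≤ k := by exact_mod_cast hk8
  have hk0 : (0 : ℝ) < k := by linarith
  have hlog : Real.logb 2 (n : ℝ) = k := by
    rw [hn, Nat.cast_pow, Nat.cast_ofNat, Real.logb_pow, Real.logb_self_eq_one one_lt_two, mul_one]
  have hdeg : ∀ (v : V) (Y : Finset V), (G.neighborFinset v ∩ Y).card < 2 ^ k := fun v Y => by
    have h₁ := Finset.card_le_card (Finset.inter_subset_left (s₁ := G.neighborFinset v) (s₂ := Y))
    have h₂ := G.degree_lt_card_verts v
    rw [SimpleGraph.card_neighborFinset_eq_degree] at h₁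
    omega
  have hsize : ((k : ℝ) ^ 5) ^ 2 * (L + R) ≤ m := by
    have h0 : (0 : ℝ) ≤ ((L : ℝ) * (R : ℝ)) ^ ((2 : ℝ) / 3) := by positivity
    rw [gt_iff_lt, lt_div_iff₀ (by positivity)] at hbig
    have : (k : ℝ) ^ 10 * (L + R) ≤ (L + R + ((L : ℝ) * R) ^ ((2 : ℝ) / 3)) * k ^ 10 := by
      rw [mul_comm]
      exact mul_le_mul_of_nonneg_right (by linarith) (by positivity)
    calc ((k : ℝ) ^ 5) ^ 2 * (L + R) = (k : ℝ) ^ 10 * (L + R) := by ring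
      _ ≤ (m : ℝ) := this.trans hbig.le
  have hAB : ∑ x ∈ A, ((G.neighborFinset x ∩ B).card : ℝ) = m := by
    rw [← eCount_eq_sum G hdisj, eCount_eq_card_edgeFinset G hbip, hm]
  have hBA : ∑ x ∈ B, ((G.neighborFinset x ∩ A).card : ℝ) = m := by
    rw [sum_card_neighborFinset_inter_comm, hAB]
  have ht : (0 : ℝ) < (k : ℝ) ^ 5 := by positivity
  obtain ⟨B₁, B₂, hBd, hBu, hB⟩ := exists_balanced_split G A B ht hAB (by
    refine le_trans ?_ hsize
    gcongr
    rw [← hL]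
    simp)
  obtain ⟨A₁, A₂, hAd, hAu, hA⟩ := exists_balanced_split G B A ht hBA (by
    refine le_trans ?_ hsize
    gcongr
    rw [← hR]
    simp)
  have hA₁ : A₁ ⊆ A := hAu ▸ Finset.subset_union_left
  have hA₂ : A₂ ⊆ A := hAu ▸ Finset.subset_union_right
  have hB₁ : B₁ ⊆ B := hBu ▸ Finset.subset_union_left
  have hB₂ : B₂ ⊆ B := hBu ▸ Finset.subset_union_right
  obtain ⟨A'', hA'', dL'', hdL'', hregA'', hlargeA''⟩ :=
    exists_dyadic_subset (fun v => (G.neighborFinset v ∩ B₂).card) A₂ (by omega : 0 < k)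
      fun v _ => hdeg v _
  obtain ⟨B', hB', dR', hdR', hregB', hlargeB'⟩ :=
    exists_dyadic_subset (fun v => (G.neighborFinset v ∩ A'').card) B₁ (by omega : 0 < k)
      fun v _ => hdeg v _
  obtain ⟨A', hA', dL', hdL', hregA', hlargeA'⟩ :=
    exists_dyadic_subset (fun v => (G.neighborFinset v ∩ B').card) A₁ (by omega : 0 < k)
      fun v _ => hdeg v _
  have hdis : ∀ {X Y : Finset V}, X ⊆ A → Y ⊆ B → Disjoint X Y := fun hX hY =>
    hdisj.mono hX hY
  obtain ⟨u, hu⟩ : ∃ u : ℝ, (m : ℝ) / k ^ 5 = u := ⟨_, rfl⟩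
  have hmu : (m : ℝ) = u * k ^ 5 := by rw [← hu, div_mul_cancel₀ _ ht.ne']
  have hu0 : 0 ≤ u := by rw [← hu]; positivity
  have htarget : (m : ℝ) / k ^ 4 = u * k := by
    rw [hmu]
    field_simp
  -- the edges from `A₂` to `B₂`
  have hA₂B₂ : u * (2 * k ^ 4 - 1) ≤ ∑ v ∈ A₂, ((G.neighborFinset v ∩ B₂).card : ℝ) := by
    have e₁ : ∑ x ∈ B, ((G.neighborFinset x ∩ A₁).card : ℝ) +
        ∑ x ∈ B, ((G.neighborFinset x ∩ A₂).card : ℝ) = m := by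
      rw [sum_card_neighborFinset_inter_comm, sum_card_neighborFinset_inter_comm G B A₂,
        ← Finset.sum_union hAd, hAu, hAB]
    have e₂ : ∑ x ∈ A₂, ((G.neighborFinset x ∩ B₁).card : ℝ) +
        ∑ x ∈ A₂, ((G.neighborFinset x ∩ B₂).card : ℝ) =
        ∑ x ∈ B, ((G.neighborFinset x ∩ A₂).card : ℝ) := by
      rw [sum_card_neighborFinset_inter_comm, sum_card_neighborFinset_inter_comm G A₂ B₂,
        ← Finset.sum_union hBd, hBu]
    have i₁ := (abs_le.1 (hA B subset_rfl)).2
    have i₂ := (abs_le.1 (hB A₂ hA₂)).2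
    rw [hu] at i₁ i₂
    have hk5 : 8 * (u * (k : ℝ) ^ 4) ≤ u * k ^ 5 := by
      have : 0 ≤ u * (k : ℝ) ^ 4 := by positivity
      nlinarith
    nlinarith
  have hA''B₂ : u * (2 * k ^ 3 - 1) ≤ ∑ v ∈ A'', ((G.neighborFinset v ∩ B₂).card : ℝ) := by
    refine le_of_mul_le_mul_left (le_trans ?_ hlargeA'') hk0
    refine le_trans ?_ hA₂B₂
    nlinarith [mul_nonneg hu0 (by linarith : (0 : ℝ) ≤ k - 1)]
  have hB₁A'' : u * (2 * k ^ 3 - 2) ≤ ∑ v ∈ B₁, ((G.neighborFinset v ∩ A'').card : ℝ) := by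
    have i := (abs_le.1 (hB A'' (hA''.trans hA₂))).1
    rw [hu] at i
    rw [sum_card_neighborFinset_inter_comm]
    linarith
  have hB'A'' : u * (2 * k ^ 2 - 1) ≤ ∑ v ∈ B', ((G.neighborFinset v ∩ A'').card : ℝ) := by
    refine le_of_mul_le_mul_left (le_trans ?_ hlargeB') hk0
    refine le_trans ?_ hB₁A''
    nlinarith [mul_nonneg hu0 (by linarith : (0 : ℝ) ≤ k - 2)]
  have hA₁B' : u * (2 * k ^ 2 - 2) ≤ ∑ v ∈ A₁, ((G.neighborFinset v ∩ B').card : ℝ) := by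
    have i := (abs_le.1 (hA B' (hB'.trans hB₁))).1
    have hmono : ∑ v ∈ B', ((G.neighborFinset v ∩ A'').card : ℝ) ≤
        ∑ v ∈ B', ((G.neighborFinset v ∩ A₂).card : ℝ) := Finset.sum_le_sum fun v _ => by
      exact_mod_cast Finset.card_le_card (Finset.inter_subset_inter_left hA'')
    rw [hu] at i
    rw [sum_card_neighborFinset_inter_comm]
    linarith
  have hA'B' : u * (2 * k - 1) ≤ ∑ v ∈ A', ((G.neighborFinset v ∩ B').card : ℝ) := by
    refine le_of_mul_le_mul_left (le_trans ?_ hlargeA') hk0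
    refine le_trans ?_ hA₁B'
    nlinarith [mul_nonneg hu0 (by linarith : (0 : ℝ) ≤ k - 2)]
  have hk2 : (k : ℝ) ≤ k ^ 2 := le_self_pow₀ (by linarith) two_ne_zero
  have hk3 : (k : ℝ) ≤ k ^ 3 := le_self_pow₀ (by linarith) three_ne_zero
  refine ⟨A', A'', B', B₂, dL', dR', dL'', hA'.trans hA₁, hA''.trans hA₂, hAd.mono hA' hA'',
    hB'.trans hB₁, hB₂, hBd.mono_left hB', hdL', hdR', hdL'', hregA', ?_, hregB', ?_, hregA'', ?_⟩
  · rw [hlog, htarget, eCount_eq_sum G (hdis (hA'.trans hA₁) (hB'.trans hB₁))]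
    exact (mul_le_mul_of_nonneg_left (by linarith) hu0).trans hA'B'
  · rw [hlog, htarget, eCount_eq_sum G (hdis (hA''.trans hA₂) (hB'.trans hB₁)).symm]
    exact (mul_le_mul_of_nonneg_left (by linarith) hu0).trans hB'A''
  · rw [hlog, htarget, eCount_eq_sum G (hdis (hA''.trans hA₂) hB₂)]
    exact (mul_le_mul_of_nonneg_left (by linarith) hu0).trans hA''B₂
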